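/- For every integer k ≥ 1 and every feasible solution (α, d, r, f) of the second factor-revealing LP, the objective value satisfies Σ_{i=1}^{k} α_i ≤ 1.61 · (f + Σ_{i=1}^{k} d_i). In particular, the optimal value z_k of the second factor-revealing LP is at most 1.61 for every k. -/

import Mathlib

/-- Feasibility for the second factor-revealing LP with `k` indices `1,…,k`.
`r j i` is the variable `r_{j,i}` for `1 ≤ j < i ≤ k`. -/
def FRLP2Feasible (k : ℕ) (α d : ℕ → ℝ) (r : ℕ → ℕ → ℝ) (f : ℝ) : Prop :=
  (∀ i ∈ Finset.Icc 1 k, 0 ≤ α i) ∧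
  (∀ i ∈ Finset.Icc 1 k, 0 ≤ d i) ∧
  0 ≤ f ∧
  (∀ j i, 1 ≤ j → j < i → i ≤ k → 0 ≤ r j i) ∧
  (∀ i, 1 ≤ i → i < k → α i ≤ α (i + 1)) ∧
  (∀ j i, 1 ≤ j → j < i → i < k → r j (i + 1) ≤ r j i) ∧
  (∀ j i, 1 ≤ j → j < i → i ≤ k → α i ≤ r j i + d i + d j) ∧
  (∀ i ∈ Finset.Icc 1 k,
    ∑ j ∈ Finset.Icc 1 (i - 1), max (r j i - d j) 0
      + ∑ j ∈ Finset.Icc i k, max (α i - d j) 0 ≤ f)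

open Finset

/-- The point of `[0, 1]` nearest to `x`. -/
noncomputable def unitClamp (x : ℝ) : ℝ := max 0 (min 1 x)

lemma unitClamp_nonneg (x : ℝ) : 0 ≤ unitClamp x := le_max_left _ _

lemma unitClamp_le_one (x : ℝ) : unitClamp x ≤ 1 :=
  max_le zero_le_one (min_le_left _ _)

lemma unitClamp_of_one_le {x : ℝ} (h : 1 ≤ x) : unitClamp x = 1 := by
  rw [unitClamp, min_eq_left h, max_eq_right zero_le_one]

lemma unitClamp_of_nonpos {x : ℝ} (h : x ≤ 0) : unitClamp x = 0 := by
  rw [unitClamp, min_eq_right (h.trans zero_le_one), max_eq_left h]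

lemma unitClamp_of_mem {x : ℝ} (h0 : 0 ≤ x) (h1 : x ≤ 1) : unitClamp x = x := by
  rw [unitClamp, min_eq_right h1, max_eq_right h0]

lemma unitClamp_mono {x y : ℝ} (h : x ≤ y) : unitClamp x ≤ unitClamp y :=
  max_le_max le_rfl (min_le_min le_rfl h)

lemma unitClamp_sub_natCast (L : ℝ) (j : ℕ) :
    unitClamp (L - j) = min L ((j + 1 : ℕ) : ℝ) - min L (j : ℝ) := by
  push_cast
  rcases le_total L j with h | h
  · rw [unitClamp_of_nonpos (by linarith), min_eq_left h, min_eq_left (by linarith), sub_self]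
  · rcases le_total L (j + 1) with h' | h'
    · rw [unitClamp_of_mem (by linarith) (by linarith), min_eq_left h', min_eq_right h]
    · rw [unitClamp_of_one_le (by linarith), min_eq_right h', min_eq_right h]
      ring

lemma sum_Ico_unitClamp {L : ℝ} {i k : ℕ} (hi : (i : ℝ) ≤ L) (hL : L ≤ k) :
    ∑ j ∈ Ico i k, unitClamp (L - j) = L - i := by
  have hik : i ≤ k := by exact_mod_cast hi.trans hL
  simp only [unitClamp_sub_natCast]
  rw [Finset.sum_Ico_sub (fun j : ℕ => min L (j : ℝ)) hik, min_eq_left hL, min_eq_right hi]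

lemma sum_range_unitClamp {L : ℝ} {k : ℕ} (h0 : 0 ≤ L) (hL : L ≤ k) :
    ∑ j ∈ range k, unitClamp (L - j) = L := by
  rw [range_eq_Ico, sum_Ico_unitClamp (by simpa using h0) hL]
  simp

/-- Splitting the unit masses at the real threshold `L` among two families of inequalities with
weights `g` and `h`. -/
structure IsDualWeight (k : ℕ) (L : ℝ) (g h : ℕ → ℝ) : Prop where
  pos : 0 < L
  le : L ≤ k
  g_nonneg : ∀ i < k, 0 ≤ g i
  h_nonneg : ∀ i < k, 0 ≤ h i
  g_eq_zero : ∀ i < k, L ≤ i → g i = 0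
  h_eq_zero : ∀ i < k, L ≤ i → h i = 0
  mass : ∀ i < k, g i * (L - i) + h i * (k - i) = unitClamp (L - i)
  sum_g_le : ∑ i ∈ range k, g i ≤ 1
  sum_h_le : ∑ i ∈ range k, h i ≤ 0.61
  demand_le : 2 * (k - L) ≤ ∑ i ∈ range k, (i : ℝ) * (g i + h i)

lemma sum_range_mul_sum_range (k : ℕ) (p : ℕ → ℝ) (q : ℕ → ℕ → ℝ) :
    ∑ i ∈ range k, p i * ∑ j ∈ range i, q j i
      = ∑ j ∈ range k, ∑ i ∈ Ico (j + 1) k, p i * q j i := by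
  simp only [mul_sum]
  refine sum_comm' fun i j => ?_
  simp only [mem_range, mem_Ico]
  omega

lemma sum_range_mul_sum_Ico (k : ℕ) (p q : ℕ → ℝ) :
    ∑ i ∈ range k, p i * ∑ j ∈ Ico i k, q j
      = ∑ j ∈ range k, (∑ i ∈ range (j + 1), p i) * q j := by
  simp only [mul_sum, sum_mul]
  refine sum_comm' fun i j => ?_
  simp only [mem_range, mem_Ico]
  omega

/-- Weak duality: a dual weight bounds the objective. -/
lemma sum_le_of_isDualWeight {k : ℕ} {L : ℝ} {g h : ℕ → ℝ} (H : IsDualWeight k L g h)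
    {α d : ℕ → ℝ} {x : ℕ → ℕ → ℝ} {f : ℝ} (hf : 0 ≤ f) (hd : ∀ i < k, 0 ≤ d i)
    (hx : ∀ j i, 0 ≤ x j i)
    (hmono : ∀ j i i', j < i → i ≤ i' → i' < k → x j i' ≤ x j i)
    (htri : ∀ j i, j < i → i < k → α i ≤ x j i + d i + 2 * d j)
    (hopen : ∀ i < k, ∑ j ∈ range i, x j i + ∑ j ∈ Ico i k, max (α i - d j) 0 ≤ f) :
    ∑ i ∈ range k, α i ≤ 1.61 * (f + ∑ i ∈ range k, d i) := by
  obtain ⟨n, hnL, hLn⟩ : ∃ n : ℕ, (n : ℝ) < L ∧ L ≤ n + 1 := by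
    refine ⟨⌈L⌉₊ - 1, ?_, ?_⟩
    · have := Nat.ceil_lt_add_one H.pos.le
      have h1 : 1 ≤ ⌈L⌉₊ := Nat.one_le_ceil_iff.2 H.pos
      rw [Nat.cast_sub h1]
      push_cast
      linarith
    · have := Nat.le_ceil L
      have h1 : 1 ≤ ⌈L⌉₊ := Nat.one_le_ceil_iff.2 H.pos
      rw [Nat.cast_sub h1]
      push_cast
      linarith
  have hlt : ∀ i : ℕ, n < i → L ≤ i := fun i hi =>
    hLn.trans (by exact_mod_cast hi)
  set τ : ℕ → ℝ := fun j => unitClamp (L - j) with hτ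
  have hτ0 : ∀ j, 0 ≤ τ j := fun j => unitClamp_nonneg _
  have hτ1 : ∀ j, τ j ≤ 1 := fun j => unitClamp_le_one _
  have hτn : ∀ j < n, τ j = 1 := fun j hj => by
    have : ((j + 1 : ℕ) : ℝ) ≤ n := by exact_mod_cast hj
    push_cast at this
    exact unitClamp_of_one_le (by linarith)
  set w : ℕ → ℝ := fun j => ∑ i ∈ Ico (j + 1) k, (g i + h i) with hw
  have hgh : ∀ i < k, 0 ≤ g i + h i := fun i hi =>
    add_nonneg (H.g_nonneg i hi) (H.h_nonneg i hi)
  have hghn : ∀ i < k, n < i → g i + h i = 0 := fun i hi hni => by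
    rw [H.g_eq_zero i hi (hlt i hni), H.h_eq_zero i hi (hlt i hni), add_zero]
  have hw0 : ∀ j, 0 ≤ w j := fun j => sum_nonneg fun i hi => hgh i (mem_Ico.1 hi).2
  have hwn : ∀ j, n ≤ j → w j = 0 := fun j hj => sum_eq_zero fun i hi => by
    have := mem_Ico.1 hi
    exact hghn i this.2 (by omega)
  have hW : ∑ j ∈ range k, w j = ∑ i ∈ range k, (i : ℝ) * (g i + h i) := by
    have := sum_range_mul_sum_range k (fun i => g i + h i) (fun _ _ => 1)
    simp only [mul_one, sum_const, card_range, nsmul_eq_mul] at this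
    rw [hw, ← this]
    exact sum_congr rfl fun i _ => mul_comm _ _
  -- the opening constraints, truncated at `L` or not
  have hstep : ∀ i < k, τ i * α i ≤ (g i + h i) * f - (g i + h i) * ∑ j ∈ range i, x j i
      + (g i * ∑ j ∈ Ico i k, τ j * d j + h i * ∑ j ∈ Ico i k, d j) := by
    intro i hi
    have hmax : ∀ t : ℕ → ℝ, (∀ j, 0 ≤ t j) → (∀ j, t j ≤ 1) →
        (∑ j ∈ Ico i k, t j) * α i
          ≤ f - ∑ j ∈ range i, x j i + ∑ j ∈ Ico i k, t j * d j := by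
      intro t ht0 ht1
      have h1 : ∑ j ∈ Ico i k, t j * (α i - d j) ≤ ∑ j ∈ Ico i k, max (α i - d j) 0 := by
        refine sum_le_sum fun j _ => ?_
        calc t j * (α i - d j) ≤ t j * max (α i - d j) 0 :=
              mul_le_mul_of_nonneg_left (le_max_left _ _) (ht0 j)
          _ ≤ 1 * max (α i - d j) 0 :=
              mul_le_mul_of_nonneg_right (ht1 j) (le_max_right _ _)
          _ = _ := one_mul _
      simp only [mul_sub, sum_sub_distrib, ← sum_mul] at h1
      linarith [hopen i hi]
    have hB : h i * ((k - i) * α i)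
        ≤ h i * (f - ∑ j ∈ range i, x j i + ∑ j ∈ Ico i k, d j) := by
      refine mul_le_mul_of_nonneg_left ?_ (H.h_nonneg i hi)
      have := hmax (fun _ => 1) (fun _ => zero_le_one) (fun _ => le_rfl)
      simpa [Nat.cast_sub hi.le] using this
    have hA : g i * ((L - i) * α i)
        ≤ g i * (f - ∑ j ∈ range i, x j i + ∑ j ∈ Ico i k, τ j * d j) := by
      rcases le_or_gt L i with hLi | hLi
      · rw [H.g_eq_zero i hi hLi, zero_mul, zero_mul]
      · refine mul_le_mul_of_nonneg_left ?_ (H.g_nonneg i hi)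
        have := hmax τ hτ0 hτ1
        rwa [hτ, sum_Ico_unitClamp hLi.le H.le] at this
    have hm : τ i * α i = g i * ((L - i) * α i) + h i * ((k - i) * α i) := by
      rw [hτ]
      simp only [← H.mass i hi]
      ring
    rw [hm]
    linarith
  have hmain := sum_le_sum fun i hi => hstep i (mem_range.1 hi)
  simp only [sum_add_distrib, sum_sub_distrib] at hmain
  rw [← sum_mul, sum_range_mul_sum_Ico, sum_range_mul_sum_Ico, sum_add_distrib] at hmain
  -- the triangle constraints
  set R : ℝ := ∑ j ∈ range k, w j * (2 * d j + x j n) with hR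
  have hR0 : 0 ≤ R := sum_nonneg fun j hj =>
    mul_nonneg (hw0 j) (by linarith [hd j (mem_range.1 hj), hx j n])
  have hQ : ∑ i ∈ range k, (1 - τ i) = k - L := by
    rw [sum_sub_distrib, hτ, sum_range_unitClamp H.pos.le H.le]
    simp
  have htail : ∑ i ∈ range k, (1 - τ i) * α i
      ≤ ∑ i ∈ range k, (1 - τ i) * d i + R / 2 := by
    have h1 : ∀ i ∈ range k, (1 - τ i) * ((∑ j ∈ range k, w j) * α i)
        ≤ (1 - τ i) * ((∑ j ∈ range k, w j) * d i + R) := by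
      intro i hi
      have hik := mem_range.1 hi
      rcases lt_or_ge i n with hin | hin
      · rw [hτn i hin, sub_self, zero_mul, zero_mul]
      · refine mul_le_mul_of_nonneg_left ?_ (sub_nonneg.2 (hτ1 i))
        rw [sum_mul, sum_mul, hR, ← sum_add_distrib]
        refine sum_le_sum fun j _ => ?_
        rw [← mul_add]
        rcases lt_or_ge j n with hjn | hjn
        · refine mul_le_mul_of_nonneg_left ?_ (hw0 j)
          linarith [htri j i (hjn.trans_le hin) hik, hmono j n i hjn hin hik]
        · rw [hwn j hjn, zero_mul, zero_mul]
    have h2 := sum_le_sum h1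
    have e1 : ∀ c : ℕ → ℝ, ∑ i ∈ range k, (1 - τ i) * ((∑ j ∈ range k, w j) * c i)
        = (∑ j ∈ range k, w j) * ∑ i ∈ range k, (1 - τ i) * c i := fun c => by
      rw [mul_sum]
      exact sum_congr rfl fun i _ => by ring
    simp only [mul_add, sum_add_distrib] at h2
    rw [e1, e1, ← sum_mul, hQ] at h2
    have h3 := H.demand_le
    rw [← hW] at h3
    have hkL : 0 ≤ (k : ℝ) - L := sub_nonneg.2 H.le
    rcases hkL.eq_or_lt with h0 | h0
    · have hq : ∀ i ∈ range k, 1 - τ i = 0 :=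
        (sum_eq_zero_iff_of_nonneg fun i _ => sub_nonneg.2 (hτ1 i)).1 (hQ.trans h0.symm)
      rw [sum_eq_zero fun i hi => by rw [hq i hi, zero_mul],
        sum_eq_zero fun i hi => by rw [hq i hi, zero_mul]]
      linarith
    · have hWpos : 0 < ∑ j ∈ range k, w j := by linarith
      refine le_of_mul_le_mul_left ?_ hWpos
      nlinarith [mul_le_mul_of_nonneg_right h3 hR0]
  have hxR : ∑ j ∈ range k, w j * x j n
      ≤ ∑ i ∈ range k, (g i + h i) * ∑ j ∈ range i, x j i := by
    rw [sum_range_mul_sum_range]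
    refine sum_le_sum fun j _ => ?_
    rw [hw, sum_mul]
    refine sum_le_sum fun i hi => ?_
    have hi' := mem_Ico.1 hi
    rcases lt_or_ge n i with hni | hni
    · rw [hghn i hi'.2 hni, zero_mul, zero_mul]
    · have hnk : n < k := by exact_mod_cast hnL.trans_le H.le
      exact mul_le_mul_of_nonneg_left (hmono j i n hi'.1 hni hnk) (hgh i hi'.2)
  have hRle : R / 2 ≤ ∑ j ∈ range k, w j * d j + ∑ j ∈ range k, w j * x j n := by
    rw [hR, sum_div, ← sum_add_distrib]
    refine sum_le_sum fun j _ => ?_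
    nlinarith [mul_nonneg (hw0 j) (hx j n)]
  have hcoef : ∑ j ∈ range k, (∑ i ∈ range (j + 1), g i) * (τ j * d j)
      + ∑ j ∈ range k, (∑ i ∈ range (j + 1), h i) * d j
      + ∑ j ∈ range k, (1 - τ j) * d j + ∑ j ∈ range k, w j * d j
      ≤ 1.61 * ∑ j ∈ range k, d j := by
    rw [← sum_add_distrib, ← sum_add_distrib, ← sum_add_distrib, mul_sum]
    refine sum_le_sum fun j hj => ?_
    have hjk := mem_range.1 hj
    have hsplit : ∀ p : ℕ → ℝ, ∑ i ∈ range (j + 1), p i + ∑ i ∈ Ico (j + 1) k, p i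
        = ∑ i ∈ range k, p i := fun p => sum_range_add_sum_Ico p hjk
    have hG := hsplit g
    have hH := hsplit h
    have hG0 : 0 ≤ ∑ i ∈ Ico (j + 1) k, g i :=
      sum_nonneg fun i hi => H.g_nonneg i (mem_Ico.1 hi).2
    have hH0 : 0 ≤ ∑ i ∈ Ico (j + 1) k, h i :=
      sum_nonneg fun i hi => H.h_nonneg i (mem_Ico.1 hi).2
    have hsg := H.sum_g_le
    have hsh := H.sum_h_le
    have key : (∑ i ∈ range (j + 1), g i) * τ j + ∑ i ∈ range (j + 1), h i + (1 - τ j) + w j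
        ≤ 1.61 := by
      rcases lt_or_ge j n with hjn | hjn
      · have : w j = ∑ i ∈ Ico (j + 1) k, g i + ∑ i ∈ Ico (j + 1) k, h i := sum_add_distrib
        rw [hτn j hjn, this]
        linarith
      · rw [hwn j hjn]
        have : (∑ i ∈ range (j + 1), g i) * τ j ≤ 1 * τ j :=
          mul_le_mul_of_nonneg_right (by linarith) (hτ0 j)
        linarith
    calc _ = ((∑ i ∈ range (j + 1), g i) * τ j + ∑ i ∈ range (j + 1), h i + (1 - τ j) + w j)
          * d j := by ring
      _ ≤ _ := mul_le_mul_of_nonneg_right key (hd j hjk)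
  have hff : (∑ i ∈ range k, g i + ∑ i ∈ range k, h i) * f ≤ 1.61 * f :=
    mul_le_mul_of_nonneg_right (by linarith [H.sum_g_le, H.sum_h_le]) hf
  have hsum : ∑ i ∈ range k, α i
      = ∑ i ∈ range k, τ i * α i + ∑ i ∈ range k, (1 - τ i) * α i := by
    rw [← sum_add_distrib]
    exact sum_congr rfl fun i _ => by ring
  rw [hsum]
  linarith

lemma div_le_log_sub_log {c p q : ℝ} (hpq : p ≤ q) (hq : q < c) :
    (q - p) / (c - p) ≤ Real.log (c - p) - Real.log (c - q) := by
  have hp : 0 < c - p := by linarith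
  have hq' : 0 < c - q := by linarith
  have := Real.one_sub_inv_le_log_of_pos (div_pos hp hq')
  rw [Real.log_div hp.ne' hq'.ne', inv_div] at this
  convert this using 1
  field_simp
  ring

lemma sum_unitClamp_sub_div_le {k : ℕ} {c s t : ℝ} (hs : 0 ≤ s) (hst : s ≤ t) (htc : t < c)
    (htk : t ≤ k) :
    ∑ i ∈ range k, (unitClamp (t - i) - unitClamp (s - i)) / (c - i)
      ≤ Real.log (c - s) - Real.log (c - t) := by
  have hterm : ∀ i ∈ range k, (unitClamp (t - i) - unitClamp (s - i)) / (c - i)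
      ≤ (Real.log (c - min s ((i + 1 : ℕ) : ℝ)) - Real.log (c - min t ((i + 1 : ℕ) : ℝ)))
        - (Real.log (c - min s (i : ℝ)) - Real.log (c - min t (i : ℝ))) := by
    intro i _
    rw [unitClamp_sub_natCast, unitClamp_sub_natCast]
    push_cast
    rcases le_total t i with hti | hti
    · rw [min_eq_left hti, min_eq_left (hst.trans hti), min_eq_left (by linarith : t ≤ i + 1),
        min_eq_left (by linarith : s ≤ i + 1)]
      simp
    · set q := min t ((i : ℝ) + 1) with hq
      have hqt : q ≤ t := min_le_left _ _
      have hiq : (i : ℝ) ≤ q := le_min hti (by linarith)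
      rw [min_eq_right hti]
      rcases le_total s i with hsi | hsi
      · rw [min_eq_left hsi, min_eq_left (by linarith : s ≤ i + 1)]
        have := div_le_log_sub_log hiq (hqt.trans_lt htc)
        simp only [sub_self, sub_zero]
        linarith
      · rw [min_eq_right hsi]
        set p := min s ((i : ℝ) + 1) with hp
        have hip : (i : ℝ) ≤ p := le_min hsi (by linarith)
        have hpq : p ≤ q := min_le_min hst le_rfl
        have h1 := div_le_log_sub_log hpq (hqt.trans_lt htc)
        have h2 : (q - p) / (c - i) ≤ (q - p) / (c - p) :=
          div_le_div_of_nonneg_left (by linarith) (by linarith) (by linarith)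
        rw [sub_sub_sub_cancel_right]
        linarith
  refine (sum_le_sum hterm).trans (le_of_eq ?_)
  rw [sum_range_sub (fun i : ℕ => Real.log (c - min s (i : ℝ)) - Real.log (c - min t (i : ℝ)))]
  simp [min_eq_left htk, min_eq_left (hst.trans htk), hs, hs.trans hst]

lemma log_sub_log_le_sum_unitClamp_div {k : ℕ} {c t : ℝ} (ht : 0 ≤ t) (htc : t < c)
    (htk : t ≤ k) :
    Real.log (c + 1) - Real.log (c + 1 - t) ≤ ∑ i ∈ range k, unitClamp (t - i) / (c - i) := by
  have hterm : ∀ i ∈ range k, Real.log (c + 1 - min t (i : ℝ))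
      - Real.log (c + 1 - min t ((i + 1 : ℕ) : ℝ)) ≤ unitClamp (t - i) / (c - i) := by
    intro i _
    rw [unitClamp_sub_natCast]
    push_cast
    rcases le_total t i with hti | hti
    · rw [min_eq_left hti, min_eq_left (by linarith : t ≤ i + 1)]
      simp
    · set q := min t ((i : ℝ) + 1) with hq
      have hqt : q ≤ t := min_le_left _ _
      have hqi : q ≤ i + 1 := min_le_right _ _
      have hiq : (i : ℝ) ≤ q := le_min hti (by linarith)
      rw [min_eq_right hti]
      have hA : 0 < c + 1 - i := by linarith
      have hB : 0 < c + 1 - q := by linarith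
      have hlog := Real.log_le_sub_one_of_pos (div_pos hA hB)
      rw [Real.log_div hA.ne' hB.ne'] at hlog
      refine hlog.trans ?_
      have e : (c + 1 - i) / (c + 1 - q) - 1 = (q - i) / (c + 1 - q) := by
        field_simp
        ring
      rw [e]
      rcases hiq.eq_or_lt with h | h
      · rw [← h]
        simp
      · exact div_le_div_of_nonneg_left (by linarith) (by linarith) (by linarith)
  refine le_trans (le_of_eq ?_) (sum_le_sum hterm)
  rw [sum_range_sub' (fun i : ℕ => Real.log (c + 1 - min t (i : ℝ)))]
  simp [min_eq_left htk, ht]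

lemma continuous_unitClamp : Continuous unitClamp := by
  unfold unitClamp
  fun_prop

lemma unitClamp_div_max {L t : ℝ} (h : t ≤ L - 1 / 10) (i : ℕ) :
    unitClamp (t - i) / max (L - i) (1 / 10) = unitClamp (t - i) / (L - i) := by
  rcases le_total t i with hti | hti
  · rw [unitClamp_of_nonpos (by linarith), zero_div, zero_div]
  · rw [max_eq_left (by linarith)]

lemma sum_unitClamp_div_max_lt_one {k : ℕ} {L : ℝ} (hL : 2 ≤ L) (hLk : L ≤ k) :
    ∑ i ∈ range k, unitClamp (0.632 * L - i) / max (L - i) (1 / 10) < 1 := by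
  simp only [unitClamp_div_max (show 0.632 * L ≤ L - 1 / 10 by linarith)]
  have h := sum_unitClamp_sub_div_le (k := k) (c := L) (s := 0) (t := 0.632 * L) le_rfl
    (by linarith) (by linarith) (by linarith)
  have h0 : ∀ i : ℕ, unitClamp (0 - i) = 0 := fun i =>
    unitClamp_of_nonpos (by simp)
  simp only [h0, sub_zero] at h
  refine h.trans_lt ?_
  rw [← Real.log_div (by linarith) (by linarith), Real.log_lt_iff_lt_exp
    (div_pos (by linarith) (by linarith)), div_lt_iff₀ (by linarith)]
  nlinarith [Real.exp_one_gt_d9]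

lemma one_le_sum_unitClamp_div_max {k : ℕ} {L : ℝ} (hL : 2 ≤ L) (hLk : L ≤ k) :
    1 ≤ ∑ i ∈ range k, unitClamp (0.7 * L + 0.5 - i) / max (L - i) (1 / 10) := by
  simp only [unitClamp_div_max (show 0.7 * L + 0.5 ≤ L - 1 / 10 by linarith)]
  refine le_trans ?_ (log_sub_log_le_sum_unitClamp_div (by linarith) (by linarith) (by linarith))
  rw [← Real.log_div (by linarith) (by linarith), Real.le_log_iff_exp_le
    (div_pos (by linarith) (by linarith)), le_div_iff₀ (by linarith)]
  nlinarith [Real.exp_one_lt_d9]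

lemma log_sub_log_le_of_eq {k L : ℝ} (hk : 0 < k) (hL : L = 0.695 * k) :
    Real.log (k - 0.632 * L) - Real.log (k - L) ≤ 0.61 := by
  rw [← Real.log_div (by linarith) (by linarith), Real.log_le_iff_le_exp
    (div_pos (by linarith) (by linarith)), div_le_iff₀ (by linarith)]
  have h := Real.sum_le_exp_of_nonneg (x := 0.61) (by norm_num) 6
  simp only [sum_range_succ, sum_range_zero, Nat.factorial] at h
  norm_num at h
  nlinarith

lemma harmonic_lower_bound {k : ℕ} (hk : 3 ≤ k) : 1.61 ≤ ∑ i ∈ range k, 1 / ((k : ℝ) - i) := by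
  have e : ∑ i ∈ range k, 1 / ((k : ℝ) - i) = ∑ i ∈ range k, 1 / ((i : ℝ) + 1) := by
    rw [← sum_range_reflect]
    refine sum_congr rfl fun i hi => ?_
    have : k - 1 - i + (i + 1) = k := by have := mem_range.1 hi; omega
    have : ((k - 1 - i : ℕ) : ℝ) + (i + 1) = k := by exact_mod_cast this
    congr 1
    linarith
  rw [e]
  calc (1.61 : ℝ) ≤ ∑ i ∈ range 3, 1 / ((i : ℝ) + 1) := by
        simp only [sum_range_succ, sum_range_zero]
        norm_num
    _ ≤ _ := sum_le_sum_of_subset_of_nonneg (range_mono hk) fun i _ _ => by positivity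

lemma exists_isDualWeight_of_three_le {k : ℕ} (hk : 3 ≤ k) :
    ∃ L g h, IsDualWeight k L g h := by
  have hk3 : (3 : ℝ) ≤ k := by exact_mod_cast hk
  set D : ℕ → ℝ → ℝ := fun i L => max (L - i) (1 / 10) with hD
  have hDpos : ∀ i L, 0 < D i L := fun i L => lt_max_of_lt_right (by norm_num)
  set P : ℕ → ℝ → ℝ := fun i L => unitClamp (0.632 * L - i) with hP
  set N : ℕ → ℝ → ℝ := fun i L => unitClamp (0.7 * L + 0.5 - i) with hN
  set a : ℝ → ℝ := fun L => ∑ i ∈ range k, P i L / D i L with ha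
  set b : ℝ → ℝ := fun L => ∑ i ∈ range k, N i L / D i L with hb
  set κ : ℝ → ℝ := fun L => (1 - a L) / (b L - a L) with hκ
  set u : ℕ → ℝ → ℝ := fun i L => P i L + κ L * (N i L - P i L) with hu
  set F : ℝ → ℝ := fun L => ∑ i ∈ range k, (unitClamp (L - i) - u i L) / (k - i) with hF
  have hcD : ∀ i, Continuous (D i) := fun i => by rw [hD]; fun_prop
  have hcP : ∀ i, Continuous (P i) := fun i =>
    continuous_unitClamp.comp (by fun_prop)
  have hcN : ∀ i, Continuous (N i) := fun i =>
    continuous_unitClamp.comp (by fun_prop)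
  have hca : Continuous a := continuous_finsetSum _ fun i _ =>
    (hcP i).div (hcD i) fun L => (hDpos i L).ne'
  have hcb : Continuous b := continuous_finsetSum _ fun i _ =>
    (hcN i).div (hcD i) fun L => (hDpos i L).ne'
  have hmem : ∀ L ∈ Set.Icc (0.695 * (k : ℝ)) k, 2 ≤ L ∧ L ≤ k := fun L hL =>
    ⟨by linarith [hL.1], hL.2⟩
  have ha1 : ∀ L ∈ Set.Icc (0.695 * (k : ℝ)) k, a L < 1 := fun L hL =>
    sum_unitClamp_div_max_lt_one (hmem L hL).1 (hmem L hL).2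
  have hb1 : ∀ L ∈ Set.Icc (0.695 * (k : ℝ)) k, 1 ≤ b L := fun L hL =>
    one_le_sum_unitClamp_div_max (hmem L hL).1 (hmem L hL).2
  have hcκ : ContinuousOn κ (Set.Icc (0.695 * (k : ℝ)) k) :=
    ((continuous_const.sub hca).continuousOn).div ((hcb.sub hca).continuousOn) fun L hL => by
      have := ha1 L hL
      have := hb1 L hL
      linarith
  have hcF : ContinuousOn F (Set.Icc (0.695 * (k : ℝ)) k) := by
    refine continuousOn_finsetSum _ fun i _ => ContinuousOn.div_const ?_ _
    have h1 : Continuous fun L : ℝ => unitClamp (L - i) :=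
      continuous_unitClamp.comp (by fun_prop)
    exact h1.continuousOn.sub
      ((hcP i).continuousOn.add (hcκ.mul ((hcN i).sub (hcP i)).continuousOn))
  have hκ0 : ∀ L ∈ Set.Icc (0.695 * (k : ℝ)) k, 0 ≤ κ L := fun L hL =>
    div_nonneg (by linarith [ha1 L hL]) (by linarith [ha1 L hL, hb1 L hL])
  have hκ1 : ∀ L ∈ Set.Icc (0.695 * (k : ℝ)) k, κ L ≤ 1 := fun L hL =>
    div_le_one_of_le₀ (by linarith [hb1 L hL]) (by linarith [ha1 L hL, hb1 L hL])
  have hPN : ∀ L ∈ Set.Icc (0.695 * (k : ℝ)) k, ∀ i, P i L ≤ N i L := fun L hL i =>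
    unitClamp_mono (by linarith [(hmem L hL).1])
  have hPu : ∀ L ∈ Set.Icc (0.695 * (k : ℝ)) k, ∀ i, P i L ≤ u i L := fun L hL i =>
    le_add_of_nonneg_right (mul_nonneg (hκ0 L hL) (sub_nonneg.2 (hPN L hL i)))
  have huN : ∀ L ∈ Set.Icc (0.695 * (k : ℝ)) k, ∀ i, u i L ≤ N i L := fun L hL i => by
    have := mul_le_mul_of_nonneg_right (hκ1 L hL) (sub_nonneg.2 (hPN L hL i))
    simp only [hu]
    linarith
  have hsumu : ∀ L ∈ Set.Icc (0.695 * (k : ℝ)) k, ∑ i ∈ range k, u i L / D i L = 1 := by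
    intro L hL
    have hne : b L - a L ≠ 0 := by linarith [ha1 L hL, hb1 L hL]
    have : ∑ i ∈ range k, u i L / D i L = a L + κ L * (b L - a L) := by
      rw [ha, hb]
      simp only
      rw [← sum_sub_distrib, mul_sum, ← sum_add_distrib]
      exact sum_congr rfl fun i _ => by simp only [hu]; ring
    rw [this, hκ]
    simp only
    rw [div_mul_cancel₀ _ hne]
    ring
  have hki : ∀ i ∈ range k, (1 : ℝ) ≤ k - i := fun i hi => by
    have : ((i + 1 : ℕ) : ℝ) ≤ k := by exact_mod_cast mem_range.1 hi
    push_cast at this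
    linarith
  have hleft : F (0.695 * k) ≤ 0.61 := by
    have hm : 0.695 * (k : ℝ) ∈ Set.Icc (0.695 * (k : ℝ)) k := ⟨le_rfl, by linarith⟩
    refine le_trans (le_trans (sum_le_sum fun i hi => ?_)
      (sum_unitClamp_sub_div_le (k := k) (c := k) (s := 0.632 * (0.695 * k)) (t := 0.695 * k)
        (by linarith) (by linarith) (by linarith) (by linarith)))
      (log_sub_log_le_of_eq (by linarith) rfl)
    exact div_le_div_of_nonneg_right (sub_le_sub_left (hPu _ hm i) _) (by linarith [hki i hi])
  have hright : 0.61 ≤ F k := by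
    have hm : (k : ℝ) ∈ Set.Icc (0.695 * (k : ℝ)) k := ⟨by linarith, le_rfl⟩
    have : F k = ∑ i ∈ range k, 1 / ((k : ℝ) - i) - ∑ i ∈ range k, u i k / D i k := by
      rw [hF, ← sum_sub_distrib]
      refine sum_congr rfl fun i hi => ?_
      rw [unitClamp_of_one_le (hki i hi), hD]
      simp only
      rw [max_eq_left (by linarith [hki i hi]), sub_div]
    rw [this, hsumu _ hm]
    linarith [harmonic_lower_bound hk]
  obtain ⟨L, hL, hFL⟩ := intermediate_value_Icc (by linarith) hcF ⟨hleft, hright⟩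
  obtain ⟨hL2, hLk⟩ := hmem L hL
  have hu0 : ∀ i, 0 ≤ u i L := fun i => (unitClamp_nonneg _).trans (hPu L hL i)
  have huτ : ∀ i, u i L ≤ unitClamp (L - i) := fun i =>
    (huN L hL i).trans (unitClamp_mono (by linarith))
  have hmass : ∀ i, u i L / D i L * (L - i) = u i L := by
    intro i
    rcases le_total (0.7 * L + 0.5) i with hi | hi
    · have : u i L = 0 := le_antisymm
        ((huN L hL i).trans_eq (unitClamp_of_nonpos (by linarith))) (hu0 i)
      rw [this, zero_div, zero_mul]
    · rw [hD]
      simp only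
      rw [max_eq_left (by linarith), div_mul_cancel₀ _ (by linarith)]
  have hmass' : ∀ i < k, u i L / D i L * (L - i)
      + (unitClamp (L - i) - u i L) / (k - i) * (k - i) = unitClamp (L - i) := fun i hi => by
    rw [hmass, div_mul_cancel₀ _ (by linarith [hki i (mem_range.2 hi)])]
    ring
  refine ⟨L, fun i => u i L / D i L, fun i => (unitClamp (L - i) - u i L) / (k - i),
    by linarith, hLk, fun i _ => div_nonneg (hu0 i) (hDpos i L).le,
    fun i hi => div_nonneg (sub_nonneg.2 (huτ i)) (by linarith [hki i (mem_range.2 hi)]),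
    fun i _ hLi => ?_, fun i _ hLi => ?_, hmass', (hsumu L hL).le, hFL.le, ?_⟩
  · have := huτ i
    rw [unitClamp_of_nonpos (by linarith)] at this
    rw [le_antisymm this (hu0 i), zero_div]
  · have := huτ i
    rw [unitClamp_of_nonpos (by linarith)] at this ⊢
    rw [le_antisymm this (hu0 i), sub_self, zero_div]
  · have e : ∑ i ∈ range k, (i : ℝ) * (u i L / D i L + (unitClamp (L - i) - u i L) / (k - i))
        = L * ∑ i ∈ range k, u i L / D i L + k * F L - ∑ i ∈ range k, unitClamp (L - i) := by
      rw [hF, mul_sum, mul_sum, ← sum_add_distrib, ← sum_sub_distrib]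
      refine sum_congr rfl fun i hi => ?_
      have := hmass' i (mem_range.1 hi)
      linear_combination -this
    rw [e, hsumu L hL, hFL, sum_range_unitClamp (by linarith) hLk]
    linarith [hL.1]

lemma exists_isDualWeight {k : ℕ} (hk : 1 ≤ k) : ∃ L g h, IsDualWeight k L g h := by
  rcases le_or_gt 3 k with h3 | h3
  · exact exists_isDualWeight_of_three_le h3
  · have c1 : unitClamp 1 = 1 := unitClamp_of_one_le le_rfl
    have c2 : unitClamp 2 = 1 := unitClamp_of_one_le one_le_two
    interval_cases k
    · refine ⟨1, fun _ => 1, fun _ => 0, ?_⟩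
      constructor <;> norm_num [c1]
    · refine ⟨2, fun _ => 1 / 2, fun i => i / 2, ?_⟩
      constructor
      case mass =>
        intro i hi
        interval_cases i <;> norm_num [c1, c2]
      case g_eq_zero | h_eq_zero =>
        intro i hi h2
        have : ((i : ℕ) : ℝ) < (2 : ℕ) := by exact_mod_cast hi
        push_cast at this
        linarith
      case h_nonneg => intro i _; positivity
      all_goals norm_num [sum_range_succ]

/-- Every feasible solution of the second factor-revealing LP has objective value at most
`1.61 · (f + Σ d_i)`; in particular `z_k ≤ 1.61` for every `k ≥ 1`. -/
theorem frlp2_objective_le (k : ℕ) (hk : 1 ≤ k) (α d : ℕ → ℝ) (r : ℕ → ℕ → ℝ) (f : ℝ)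
    (hfeas : FRLP2Feasible k α d r f) :
    ∑ i ∈ Finset.Icc 1 k, α i ≤ 1.61 * (f + ∑ i ∈ Finset.Icc 1 k, d i) := by
  obtain ⟨-, hd, hf, -, -, hmono, htri, hopen⟩ := hfeas
  obtain ⟨L, g, h, H⟩ := exists_isDualWeight hk
  have hshift : ∀ (c : ℕ → ℝ) (m n : ℕ), ∑ i ∈ Icc (m + 1) n, c i = ∑ i ∈ Ico m n, c (i + 1) :=
    fun c m n => by
      rw [sum_Ico_add' c m n 1]
      rfl
  have hanti : ∀ j i i', j < i → i ≤ i' → i' < k → r (j + 1) (i' + 1) ≤ r (j + 1) (i + 1) := by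
    intro j i i' hji hii'
    induction i', hii' using Nat.le_induction with
    | base => exact fun _ => le_rfl
    | succ m him ih =>
      exact fun hm => (hmono (j + 1) (m + 1) (by omega) (by omega) hm).trans (ih (by omega))
  have main := sum_le_of_isDualWeight H (α := fun i => α (i + 1)) (d := fun i => d (i + 1))
    (x := fun j i => max (r (j + 1) (i + 1) - d (j + 1)) 0) hf
    (fun i hi => hd (i + 1) (mem_Icc.2 ⟨by omega, hi⟩))
    (fun _ _ => le_max_right _ _)
    (fun j i i' hji hii' hi' =>
      max_le_max (sub_le_sub_right (hanti j i i' hji hii' hi') _) le_rfl)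
    (fun j i hji hik => by
      have h1 := htri (j + 1) (i + 1) (by omega) (by omega) hik
      have h2 := le_max_left (r (j + 1) (i + 1) - d (j + 1)) 0
      linarith)
    (fun i hik => by
      have h1 := hopen (i + 1) (mem_Icc.2 ⟨by omega, hik⟩)
      have h2 := hshift (fun j => max (r j (i + 1) - d j) 0) 0 i
      rw [zero_add] at h2
      rw [Nat.add_sub_cancel, h2, hshift _ i k, ← range_eq_Ico] at h1
      exact h1)
  have e : ∀ c : ℕ → ℝ, ∑ i ∈ Icc 1 k, c i = ∑ i ∈ range k, c (i + 1) := fun c => by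
    rw [range_eq_Ico, ← hshift c 0 k]
  rw [e α, e d]
  exact main
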